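/- arXiv:2402.02434 — 2 statements merged into one kernel-verified Lean document; each statement's English description precedes it below -/
import Mathlib

section
/- Let 0 < η ≤ 1 and r ∈ (0,1). Let (F_k)_{k≥0} and (G_k)_{k≥0} be Schur chains whose Szegő constants satisfy η(F) ≥ η and η(G) ≥ η. Then for every n ∈ ℕ one has |F_n(0) − G_n(0)| ≤ C(η,r) · r^{−n} · ‖F_0 − G_0‖_{L²(r𝕋)}. -/
open Complex Metric Finset Filter

noncomputable section

/-- A Schur chain: each `F k` is analytic on the open unit disc, bounded by `1` there,
`‖F k 0‖ < 1`, and the Schur algorithm recursion holds. -/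
def IsSchurChain (F : ℕ → ℂ → ℂ) : Prop :=
  ∀ k : ℕ,
    DifferentiableOn ℂ (F k) (Metric.ball 0 1) ∧
    (∀ z ∈ Metric.ball (0 : ℂ) 1, ‖F k z‖ ≤ 1) ∧
    ‖F k 0‖ < 1 ∧
    ∀ z ∈ Metric.ball (0 : ℂ) 1,
      z * F (k + 1) z * (1 - (starRingEnd ℂ) (F k 0) * F k z) = F k z - F k 0

/-- The Szegő constant of a Schur chain: the limit (equivalently the infimum, since the
partial products are nonincreasing and lie in `[0,1]`) of `∏_{k<N} (1 - ‖F k 0‖²)`. -/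
def szego (F : ℕ → ℂ → ℂ) : ℝ :=
  ⨅ N : ℕ, ∏ k ∈ Finset.range N, (1 - ‖F k 0‖ ^ 2)

/-- The constant `C(η, r)`. -/
def Cconst (η r : ℝ) : ℝ :=
  Real.exp (Real.log (1 / η) * (2 + 1 / (1 - Real.sqrt (1 - η))) * (4 / (1 - r) ^ 2 + 1))

/-- `‖H‖_{L²(r𝕋)}`, the `L²` norm of `H` on the circle of radius `r`,
with respect to the normalized Lebesgue measure on the circle. -/
def L2rT (H : ℂ → ℂ) (r : ℝ) : ℝ :=
  Real.sqrt ((2 * Real.pi)⁻¹ *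
    ∫ θ in (0:ℝ)..(2 * Real.pi), ‖H (r * Complex.exp (θ * Complex.I))‖ ^ 2)

/-- The squared norm on the circle of radius `r`, as a circle average. -/
def Qsq (H : ℂ → ℂ) (r : ℝ) : ℝ := Real.circleAverage (fun z => ‖H z‖ ^ 2) 0 r

lemma L2rT_eq (H : ℂ → ℂ) (r : ℝ) : L2rT H r = Real.sqrt (Qsq H r) := by
  unfold L2rT Qsq Real.circleAverage
  simp [circleMap]

lemma Qsq_nonneg (H : ℂ → ℂ) (r : ℝ) : 0 ≤ Qsq H r :=
  Real.circleAverage_nonneg_of_nonneg (fun _ _ => by positivity)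

lemma avg_formula (h : ℂ → ℂ) (r : ℝ) (hr0 : 0 < r) (hr1 : r < 1)
    (hd : DifferentiableOn ℂ h (ball 0 1)) (p q : ℝ) :
    CircleIntegrable (fun z => p * ‖h z‖ ^ 2 + (q * ‖h 0‖ ^ 2
        + (-2) * ((starRingEnd ℂ) (h 0) * h z).re)) 0 r ∧
    Real.circleAverage (fun z => p * ‖h z‖ ^ 2 + (q * ‖h 0‖ ^ 2
        + (-2) * ((starRingEnd ℂ) (h 0) * h z).re)) 0 r
      = p * Qsq h r + (q - 2) * ‖h 0‖ ^ 2 := by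
  have hsub : closedBall (0 : ℂ) r ⊆ ball 0 1 := closedBall_subset_ball hr1
  have hc : ContinuousOn h (sphere 0 r) :=
    hd.continuousOn.mono (sphere_subset_closedBall.trans hsub)
  have hmean : Real.circleAverage (fun z => (starRingEnd ℂ) (h 0) * h z) 0 r
      = (starRingEnd ℂ) (h 0) * h 0 := by
    have : DiffContOnCl ℂ (fun z => (starRingEnd ℂ) (h 0) * h z) (ball 0 |r|) := by
      rw [abs_of_pos hr0]
      apply DifferentiableOn.diffContOnCl
      rw [closure_ball _ hr0.ne']
      exact (hd.mono hsub).const_mul _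
    simpa using this.circleAverage
  have hre : Real.circleAverage (fun z => ((starRingEnd ℂ) (h 0) * h z).re) 0 r = ‖h 0‖ ^ 2 := by
    have h1 := Complex.reCLM.circleAverage_comp_comm (c := 0) (R := r)
      (f := fun z => (starRingEnd ℂ) (h 0) * h z)
      (ContinuousOn.circleIntegrable hr0.le (by fun_prop))
    rw [hmean] at h1
    have h2 : (reCLM ∘ fun z => (starRingEnd ℂ) (h 0) * h z)
      = fun z => ((starRingEnd ℂ) (h 0) * h z).re := rfl
    rw [h2] at h1
    rw [h1, Complex.conj_mul']
    simp [← Complex.ofReal_pow]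
  have hcre : ContinuousOn (fun z => ((starRingEnd ℂ) (h 0) * h z).re) (sphere 0 r) :=
    Complex.continuous_re.comp_continuousOn (by fun_prop)
  have i1 : CircleIntegrable (fun z => p * ‖h z‖ ^ 2) 0 r :=
    ContinuousOn.circleIntegrable hr0.le (by fun_prop)
  have i2 : CircleIntegrable (fun _ : ℂ => q * ‖h 0‖ ^ 2) 0 r :=
    ContinuousOn.circleIntegrable hr0.le (by fun_prop)
  have i3 : CircleIntegrable (fun z => (-2) * ((starRingEnd ℂ) (h 0) * h z).re) 0 r :=
    ContinuousOn.circleIntegrable hr0.le (by fun_prop)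
  have i4 : CircleIntegrable (fun z => q * ‖h 0‖ ^ 2
      + (-2) * ((starRingEnd ℂ) (h 0) * h z).re) 0 r :=
    ContinuousOn.circleIntegrable hr0.le (by fun_prop)
  refine ⟨ContinuousOn.circleIntegrable hr0.le (by fun_prop), ?_⟩
  rw [Real.circleAverage_fun_add i1 i4, Real.circleAverage_fun_add i2 i3,
    Real.circleAverage_const]
  have e1 := Real.circleAverage_fun_smul (a := p) (f := fun z => ‖h z‖ ^ 2) (c := 0) (R := r)
  have e2 := Real.circleAverage_fun_smul (a := (-2 : ℝ))
    (f := fun z => ((starRingEnd ℂ) (h 0) * h z).re) (c := 0) (R := r)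
  simp only [smul_eq_mul] at e1 e2
  rw [e1, e2, hre, Qsq]
  ring

lemma norm_zero_sq_le (h : ℂ → ℂ) (r : ℝ) (hr0 : 0 < r) (hr1 : r < 1)
    (hd : DifferentiableOn ℂ h (ball 0 1)) : ‖h 0‖ ^ 2 ≤ Qsq h r := by
  have h1 := (avg_formula h r hr0 hr1 hd 1 1).2
  have h2 : 0 ≤ Real.circleAverage (fun z => 1 * ‖h z‖ ^ 2 + (1 * ‖h 0‖ ^ 2
        + (-2) * ((starRingEnd ℂ) (h 0) * h z).re)) 0 r := by
    apply Real.circleAverage_nonneg_of_nonneg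
    intro z _
    have h3 := Complex.re_le_norm ((starRingEnd ℂ) (h 0) * h z)
    rw [norm_mul, Complex.norm_conj] at h3
    nlinarith [sq_nonneg (‖h 0‖ - ‖h z‖)]
  linarith

lemma avg_step (h h1 : ℂ → ℂ) (r : ℝ) (hr0 : 0 < r) (hr1 : r < 1)
    (hd : DifferentiableOn ℂ h (ball 0 1)) (hd1 : DifferentiableOn ℂ h1 (ball 0 1))
    (K e1 e2 : ℝ) (hK : 0 ≤ K) (he1 : 0 ≤ e1) (he2 : 0 ≤ e2)
    (hp : ∀ z ∈ sphere (0 : ℂ) r,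
      r * ‖h1 z‖ ≤ K * (‖h z - h 0‖ + e1 * ‖h 0‖ + e2 * ‖h z‖)) :
    r ^ 2 * Qsq h1 r ≤ (K * (1 + e1 + e2)) ^ 2 * Qsq h r := by
  have hsub : closedBall (0 : ℂ) r ⊆ ball 0 1 := closedBall_subset_ball hr1
  have hc : ContinuousOn h1 (sphere 0 r) :=
    hd1.continuousOn.mono (sphere_subset_closedBall.trans hsub)
  obtain ⟨hi, hav⟩ := avg_formula h r hr0 hr1 hd (1 + e2) (1 + e1)
  have hnn := norm_zero_sq_le h r hr0 hr1 hd
  set f := fun z => (1 + e2) * ‖h z‖ ^ 2 + ((1 + e1) * ‖h 0‖ ^ 2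
        + (-2) * ((starRingEnd ℂ) (h 0) * h z).re) with hf
  have hmono : Real.circleAverage (fun z => r ^ 2 * ‖h1 z‖ ^ 2) 0 r
      ≤ Real.circleAverage (fun z => (K ^ 2 * (1 + e1 + e2)) • f z) 0 r := by
    apply Real.circleAverage_mono
    · exact ContinuousOn.circleIntegrable hr0.le (by fun_prop)
    · exact hi.const_smul
    · intro z hz
      rw [abs_of_pos hr0] at hz
      have h2 := hp z hz
      have h3 : ‖h z - h 0‖ ^ 2 = ‖h z‖ ^ 2 + ‖h 0‖ ^ 2
          - 2 * ((starRingEnd ℂ) (h 0) * h z).re := by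
        rw [Complex.sq_norm, Complex.sq_norm, Complex.sq_norm, Complex.normSq_sub]
        rw [mul_comm (h z)]
      have hfz : f z = ‖h z - h 0‖ ^ 2 + e1 * ‖h 0‖ ^ 2 + e2 * ‖h z‖ ^ 2 := by
        rw [h3, hf]; ring
      rw [smul_eq_mul, hfz]
      generalize ‖h z - h 0‖ = x at *
      generalize ‖h z‖ = u at *
      generalize ‖h 0‖ = v at *
      calc r ^ 2 * ‖h1 z‖ ^ 2 = (r * ‖h1 z‖) ^ 2 := by ring
        _ ≤ (K * (x + e1 * v + e2 * u)) ^ 2 := by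
            apply pow_le_pow_left₀ (by positivity) h2
        _ = K ^ 2 * (x + e1 * v + e2 * u) ^ 2 := by ring
        _ ≤ K ^ 2 * ((1 + e1 + e2) * (x ^ 2 + e1 * v ^ 2 + e2 * u ^ 2)) := by
            apply mul_le_mul_of_nonneg_left _ (by positivity)
            nlinarith [mul_nonneg he1 (sq_nonneg (x - v)), mul_nonneg he2 (sq_nonneg (x - u)),
              mul_nonneg (mul_nonneg he1 he2) (sq_nonneg (u - v))]
        _ = _ := by ring
  have e3 := Real.circleAverage_fun_smul (a := r ^ 2) (f := fun z => ‖h1 z‖ ^ 2) (c := 0) (R := r)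
  simp only [smul_eq_mul] at e3
  rw [e3, Real.circleAverage_fun_smul, hav, smul_eq_mul] at hmono
  change r ^ 2 * Qsq h1 r ≤ _ at hmono
  refine hmono.trans ?_
  have : (1 + e2) * Qsq h r + (1 + e1 - 2) * ‖h 0‖ ^ 2 ≤ (1 + e1 + e2) * Qsq h r := by
    nlinarith [mul_le_mul_of_nonneg_left hnn he1, sq_nonneg ‖h 0‖]
  calc _ ≤ K ^ 2 * (1 + e1 + e2) * ((1 + e1 + e2) * Qsq h r) :=
        mul_le_mul_of_nonneg_left this (by positivity)
    _ = _ := by ring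

/-- Sup of `F k` over the circle. -/
def Msup (F : ℕ → ℂ → ℂ) (r : ℝ) (k : ℕ) : ℝ := ⨆ z : sphere (0 : ℂ) r, ‖F k z‖

lemma mem_ball_of_sphere {r : ℝ} (hr1 : r < 1) {z : ℂ} (hz : z ∈ sphere (0 : ℂ) r) :
    z ∈ ball (0 : ℂ) 1 := (sphere_subset_closedBall.trans (closedBall_subset_ball hr1)) hz

lemma le_Msup {F : ℕ → ℂ → ℂ} (hF : IsSchurChain F) {r : ℝ} (hr1 : r < 1) (k : ℕ)
    {z : ℂ} (hz : z ∈ sphere (0 : ℂ) r) : ‖F k z‖ ≤ Msup F r k := by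
  have hb : BddAbove (Set.range fun z : sphere (0 : ℂ) r => ‖F k z‖) := by
    refine ⟨1, ?_⟩
    rintro _ ⟨w, rfl⟩
    exact (hF k).2.1 w (mem_ball_of_sphere hr1 w.2)
  exact le_ciSup hb (⟨z, hz⟩ : sphere (0 : ℂ) r)

lemma Msup_nonneg (F : ℕ → ℂ → ℂ) (r : ℝ) (k : ℕ) : 0 ≤ Msup F r k :=
  Real.iSup_nonneg fun _ => norm_nonneg _

lemma Msup_le_one {F : ℕ → ℂ → ℂ} (hF : IsSchurChain F) {r : ℝ} (hr1 : r < 1) (k : ℕ) :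
    Msup F r k ≤ 1 :=
  Real.iSup_le (fun w => (hF k).2.1 w (mem_ball_of_sphere hr1 w.2)) zero_le_one

lemma schur_bound (a w f : ℂ) (ha : ‖a‖ < 1) (hw : ‖w‖ < 1)
    (h : w * (1 - (starRingEnd ℂ) a * f) = f - a) : ‖f‖ ≤ ‖a‖ + ‖w‖ := by
  have h1 : f * (1 + (starRingEnd ℂ) a * w) = a + w := by linear_combination -h
  set t := ((starRingEnd ℂ) a * w).re with ht
  have hta : |t| ≤ ‖a‖ * ‖w‖ := by
    have := Complex.abs_re_le_norm ((starRingEnd ℂ) a * w)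
    rwa [norm_mul, Complex.norm_conj] at this
  have n1 : ‖a + w‖ ^ 2 = ‖a‖ ^ 2 + ‖w‖ ^ 2 + 2 * t := by
    rw [Complex.sq_norm, Complex.sq_norm, Complex.sq_norm, Complex.normSq_add, ht]
    simp
  have n2 : ‖1 + (starRingEnd ℂ) a * w‖ ^ 2 = 1 + ‖a‖ ^ 2 * ‖w‖ ^ 2 + 2 * t := by
    rw [Complex.sq_norm, Complex.sq_norm, Complex.sq_norm, Complex.normSq_add, ht]
    simp
  have n3 : ‖f‖ ^ 2 * ‖1 + (starRingEnd ℂ) a * w‖ ^ 2 = ‖a + w‖ ^ 2 := by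
    rw [← h1, norm_mul]; ring
  rw [n1, n2] at n3
  have ha0 := norm_nonneg a
  have hw0 := norm_nonneg w
  have hf0 := norm_nonneg f
  generalize ‖a‖ = α at *
  generalize ‖w‖ = ω at *
  generalize ‖f‖ = φ at *
  obtain ⟨ht1, ht2⟩ := abs_le.1 hta
  have haw : α * ω < 1 := by nlinarith
  have hpos : 0 < 1 + α ^ 2 * ω ^ 2 + 2 * t := by nlinarith [sq_nonneg (1 - α * ω)]
  have key : α ^ 2 + ω ^ 2 + 2 * t ≤ (α + ω) ^ 2 * (1 + α ^ 2 * ω ^ 2 + 2 * t) := by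
    have k1 : (α + ω) ^ 2 ≤ (α + ω) ^ 2 * (1 + α * ω) ^ 2 := by
      have : 1 ≤ (1 + α * ω) ^ 2 := by nlinarith [mul_nonneg ha0 hw0]
      nlinarith [sq_nonneg (α + ω)]
    have k2 : (α - ω) ^ 2 ≤ ((α + ω) * (1 - α * ω)) ^ 2 := by
      have : 0 ≤ (α + ω) * (1 - α * ω) := by
        apply mul_nonneg (by linarith) (by linarith)
      apply sq_le_sq'
      · nlinarith [mul_nonneg ha0 hw0]
      · nlinarith [mul_nonneg ha0 hw0]
    rcases eq_or_lt_of_le (mul_nonneg ha0 hw0) with h0 | h0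
    · have : t = 0 := by rw [← h0] at ht1 ht2; linarith
      have h0' : α ^ 2 * ω ^ 2 = 0 := by rw [← mul_pow, ← h0]; ring
      rw [this, h0']
      nlinarith
    · have A := mul_le_mul_of_nonneg_left k1 (by linarith : 0 ≤ t + α * ω)
      have B := mul_le_mul_of_nonneg_left k2 (by linarith : 0 ≤ α * ω - t)
      have C : 2 * (α * ω) * (α ^ 2 + ω ^ 2 + 2 * t)
          ≤ 2 * (α * ω) * ((α + ω) ^ 2 * (1 + α ^ 2 * ω ^ 2 + 2 * t)) := by
        linear_combination A + B
      exact le_of_mul_le_mul_left C (by positivity)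
  have : φ ^ 2 ≤ (α + ω) ^ 2 := by
    rw [← n3] at key
    exact le_of_mul_le_mul_right key hpos
  exact (pow_le_pow_iff_left₀ hf0 (by linarith) two_ne_zero).1 this

lemma Msup_rec {F : ℕ → ℂ → ℂ} (hF : IsSchurChain F) {r : ℝ} (hr0 : 0 < r) (hr1 : r < 1)
    (k : ℕ) : Msup F r k ≤ ‖F k 0‖ + r * Msup F r (k + 1) := by
  refine Real.iSup_le ?_ (by have := Msup_nonneg F r (k + 1); positivity)
  rintro ⟨z, hz⟩
  have hzb := mem_ball_of_sphere hr1 hz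
  have hzr : ‖z‖ = r := by simpa using hz
  have h1 := (hF (k + 1)).2.1 z hzb
  have h2 : ‖z * F (k + 1) z‖ = r * ‖F (k + 1) z‖ := by rw [norm_mul, hzr]
  have h3 := schur_bound (F k 0) (z * F (k + 1) z) (F k z) (hF k).2.2.1
    (by rw [h2]; nlinarith [norm_nonneg (F (k + 1) z)]) ((hF k).2.2.2 z hzb)
  rw [h2] at h3
  have h4 := mul_le_mul_of_nonneg_left (le_Msup hF hr1 (k + 1) hz) hr0.le
  show ‖F k z‖ ≤ _
  linarith

lemma prod_ge {F : ℕ → ℂ → ℂ} (hF : IsSchurChain F) {η : ℝ} (h : η ≤ szego F) (N : ℕ) :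
    η ≤ ∏ k ∈ Finset.range N, (1 - ‖F k 0‖ ^ 2) := by
  refine h.trans (ciInf_le ⟨0, ?_⟩ N)
  rintro _ ⟨n, rfl⟩
  apply Finset.prod_nonneg
  intro k _
  nlinarith [norm_nonneg (F k 0), (hF k).2.2.1]

lemma coeff_sq_le {F : ℕ → ℂ → ℂ} (hF : IsSchurChain F) {η : ℝ} (h : η ≤ szego F) (k : ℕ) :
    ‖F k 0‖ ≤ Real.sqrt (1 - η) := by
  apply Real.le_sqrt_of_sq_le
  have h1 := prod_ge hF h (k + 1)
  rw [Finset.prod_range_succ] at h1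
  have h2 : 0 ≤ 1 - ‖F k 0‖ ^ 2 := by nlinarith [norm_nonneg (F k 0), (hF k).2.2.1]
  have h3 : ∏ k ∈ Finset.range k, (1 - ‖F k 0‖ ^ 2) ≤ 1 := by
    apply Finset.prod_le_one
    · intro j _
      nlinarith [norm_nonneg (F j 0), (hF j).2.2.1]
    · intro j _
      nlinarith [norm_nonneg (F j 0)]
  nlinarith [mul_le_mul_of_nonneg_right h3 h2]

lemma sum_coeff_le {F : ℕ → ℂ → ℂ} (hF : IsSchurChain F) {η : ℝ} (hη0 : 0 < η)
    (h : η ≤ szego F) (N : ℕ) :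
    ∑ k ∈ Finset.range N, ‖F k 0‖ ^ 2 ≤ Real.log (1 / η) := by
  have h1 := prod_ge hF h N
  have h2 : ∏ k ∈ Finset.range N, (1 - ‖F k 0‖ ^ 2)
      ≤ Real.exp (-∑ k ∈ Finset.range N, ‖F k 0‖ ^ 2) := by
    rw [← Finset.sum_neg_distrib, Real.exp_sum]
    apply Finset.prod_le_prod
    · intro j _
      nlinarith [norm_nonneg (F j 0), (hF j).2.2.1]
    · intro j _
      have := Real.add_one_le_exp (-‖F j 0‖ ^ 2)
      linarith
  have h3 := Real.log_le_log hη0 (h1.trans h2)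
  rw [Real.log_exp] at h3
  rw [one_div, Real.log_inv]
  linarith

lemma sum_M_le {F : ℕ → ℂ → ℂ} (hF : IsSchurChain F) {η r : ℝ} (hη0 : 0 < η)
    (hr0 : 0 < r) (hr1 : r < 1) (h : η ≤ szego F) (n : ℕ) :
    ∑ k ∈ Finset.range n, Msup F r k ^ 2 ≤ Real.log (1 / η) * (1 / (1 - r) ^ 2) := by
  have hx : 0 < 1 - r := by linarith
  set M := Msup F r with hM
  have hstep : ∀ k, (1 - r) * M k ^ 2 ≤ ‖F k 0‖ ^ 2 + (1 - r) * r * M (k + 1) ^ 2 := by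
    intro k
    have h1 := Msup_rec hF hr0 hr1 k
    rw [← hM] at h1
    have h0 : 0 ≤ M k := Msup_nonneg F r k
    have h2 := pow_le_pow_left₀ h0 h1 2
    nlinarith [mul_le_mul_of_nonneg_left h2 hx.le, mul_nonneg hr0.le
      (sq_nonneg (‖F k 0‖ - (1 - r) * M (k + 1)))]
  have hsum : ∀ N, (1 - r) * ((1 - r) * ∑ k ∈ Finset.range N, M k ^ 2)
      ≤ ∑ k ∈ Finset.range N, ‖F k 0‖ ^ 2 + (1 - r) * r * (M N ^ 2 - M 0 ^ 2) := by
    intro N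
    induction N with
    | zero => simp
    | succ N ih =>
      rw [Finset.sum_range_succ, Finset.sum_range_succ]
      nlinarith [hstep N]
  have hsum2 : ∀ N, (1 - r) ^ 2 * ∑ k ∈ Finset.range N, M k ^ 2
      ≤ Real.log (1 / η) + M N ^ 2 := by
    intro N
    have h1 := hsum N
    have h2 := sum_coeff_le hF hη0 h N
    have h3 : (1 - r) * r * M N ^ 2 ≤ M N ^ 2 := by
      have : (1 - r) * r ≤ 1 := by nlinarith
      nlinarith [sq_nonneg (M N)]
    have h4 : 0 ≤ (1 - r) * r * M 0 ^ 2 := by positivity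
    nlinarith
  have hsummable : Summable (fun k => M k ^ 2) := by
    apply summable_of_sum_range_le (c := (Real.log (1 / η) + 1) / (1 - r) ^ 2)
    · intro k; positivity
    · intro N
      rw [le_div_iff₀ (by positivity)]
      have h1 := hsum2 N
      have h2 : M N ^ 2 ≤ 1 := pow_le_one₀ (Msup_nonneg F r N) (Msup_le_one hF hr1 N)
      linarith
  have hlim := hsummable.tendsto_atTop_zero
  have hlim2 : Tendsto (fun N => Real.log (1 / η) + M N ^ 2) atTop
      (nhds (Real.log (1 / η) + 0)) := hlim.const_add _
  have hfin : (1 - r) ^ 2 * ∑ k ∈ Finset.range n, M k ^ 2 ≤ Real.log (1 / η) + 0 := by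
    apply ge_of_tendsto hlim2
    filter_upwards [eventually_ge_atTop n] with N hN
    refine le_trans ?_ (hsum2 N)
    apply mul_le_mul_of_nonneg_left _ (by positivity)
    apply Finset.sum_le_sum_of_subset_of_nonneg (Finset.range_mono hN)
    intro i _ _; positivity
  rw [mul_one_div, le_div_iff₀ (by positivity)]
  linarith

lemma denom_bound {a f : ℂ} {M c : ℝ} (hc0 : 0 ≤ c) (hc1 : c < 1) (ha : ‖a‖ ≤ c)
    (hf : ‖f‖ ≤ 1) (hfM : ‖f‖ ≤ M) :
    1 ≤ ‖1 - (starRingEnd ℂ) a * f‖ * Real.exp (1 / (1 - c) * (‖a‖ * M)) := by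
  set t := ‖a‖ * ‖f‖ with ht
  have ht0 : 0 ≤ t := by positivity
  have htc : t ≤ c := by
    calc t ≤ c * 1 := mul_le_mul ha hf (norm_nonneg _) hc0
      _ = c := mul_one c
  have h1 : 1 - t ≤ ‖1 - (starRingEnd ℂ) a * f‖ := by
    have := norm_sub_norm_le (1 : ℂ) ((starRingEnd ℂ) a * f)
    rwa [norm_one, norm_mul, Complex.norm_conj] at this
  have h2 : t / (1 - t) ≤ 1 / (1 - c) * (‖a‖ * M) := by
    calc t / (1 - t) ≤ t / (1 - c) := by
          apply div_le_div_of_nonneg_left ht0 (by linarith) (by linarith)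
      _ = 1 / (1 - c) * t := by ring
      _ ≤ _ := by
          apply mul_le_mul_of_nonneg_left
          · exact mul_le_mul_of_nonneg_left hfM (norm_nonneg _)
          · exact one_div_nonneg.2 (by linarith)
  have h3 : 1 / (1 - t) ≤ Real.exp (1 / (1 - c) * (‖a‖ * M)) := by
    calc 1 / (1 - t) = t / (1 - t) + 1 := by
          have : 1 - t ≠ 0 := by linarith
          field_simp; ring
      _ ≤ Real.exp (t / (1 - t)) := Real.add_one_le_exp _
      _ ≤ _ := Real.exp_le_exp.2 h2
  calc (1 : ℝ) = (1 - t) * (1 / (1 - t)) := by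
        have : 1 - t ≠ 0 := by linarith
        field_simp
    _ ≤ _ := mul_le_mul h1 h3 (one_div_nonneg.2 (by linarith)) (norm_nonneg _)

lemma im_bound (a b : ℂ) :
    ‖a * (starRingEnd ℂ) b - (starRingEnd ℂ) a * b‖ ≤ 2 * ‖b‖ * ‖a - b‖ := by
  have : a * (starRingEnd ℂ) b - (starRingEnd ℂ) a * b
      = (a - b) * (starRingEnd ℂ) b - (starRingEnd ℂ) (a - b) * b := by
    rw [map_sub]; ring
  rw [this]
  refine (norm_sub_le _ _).trans ?_
  rw [norm_mul, norm_mul, Complex.norm_conj, Complex.norm_conj]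
  linarith

lemma pointwise_step {F G : ℕ → ℂ → ℂ} (hF : IsSchurChain F) (hG : IsSchurChain G)
    {r c : ℝ} (hr1 : r < 1) (hc0 : 0 ≤ c) (hc1 : c < 1) (k : ℕ)
    (ha : ‖F k 0‖ ≤ c) (hb : ‖G k 0‖ ≤ c) {z : ℂ} (hz : z ∈ sphere (0 : ℂ) r) :
    r * ‖F (k + 1) z - G (k + 1) z‖ ≤
      Real.exp (1 / (1 - c) * (‖F k 0‖ * Msup F r k) + 1 / (1 - c) * (‖G k 0‖ * Msup G r k)) *
      (‖(F k z - G k z) - (F k 0 - G k 0)‖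
        + (Msup F r k * Msup G r k + 2 * (‖G k 0‖ * Msup F r k)) * ‖F k 0 - G k 0‖
        + (‖F k 0‖ * ‖G k 0‖) * ‖F k z - G k z‖) := by
  have hzb := mem_ball_of_sphere hr1 hz
  have hzr : ‖z‖ = r := by simpa using hz
  have eF := (hF k).2.2.2 z hzb
  have eG := (hG k).2.2.2 z hzb
  have hFM := le_Msup hF hr1 k hz
  have hGM := le_Msup hG hr1 k hz
  have dF := denom_bound hc0 hc1 ha ((hF k).2.1 z hzb) hFM
  have dG := denom_bound hc0 hc1 hb ((hG k).2.1 z hzb) hGM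
  have hM0 := Msup_nonneg F r k
  have hN0 := Msup_nonneg G r k
  rw [Real.exp_add]
  generalize Real.exp (1 / (1 - c) * (‖F k 0‖ * Msup F r k)) = E1 at *
  generalize Real.exp (1 / (1 - c) * (‖G k 0‖ * Msup G r k)) = E2 at *
  generalize Msup F r k = M at *
  generalize Msup G r k = N at *
  generalize F (k + 1) z = f1 at *
  generalize G (k + 1) z = g1 at *
  generalize F k z = f at *
  generalize G k z = g at *
  generalize F k 0 = a at *
  generalize G k 0 = b at *
  have hid : (z * (f1 - g1)) * ((1 - (starRingEnd ℂ) a * f) * (1 - (starRingEnd ℂ) b * g))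
      = ((f - g) - (a - b)) + ((starRingEnd ℂ) (a - b) * (f * g)
        + (a * (starRingEnd ℂ) b - (starRingEnd ℂ) a * b) * f)
        - (a * (starRingEnd ℂ) b) * (f - g) := by
    rw [map_sub]
    linear_combination (1 - (starRingEnd ℂ) b * g) * eF - (1 - (starRingEnd ℂ) a * f) * eG
  have hn : ‖((f - g) - (a - b)) + ((starRingEnd ℂ) (a - b) * (f * g)
        + (a * (starRingEnd ℂ) b - (starRingEnd ℂ) a * b) * f)
        - (a * (starRingEnd ℂ) b) * (f - g)‖ ≤ ‖(f - g) - (a - b)‖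
        + (M * N + 2 * (‖b‖ * M)) * ‖a - b‖ + (‖a‖ * ‖b‖) * ‖f - g‖ := by
    refine (norm_sub_le _ _).trans ?_
    have t1 : ‖(a * (starRingEnd ℂ) b) * (f - g)‖ = (‖a‖ * ‖b‖) * ‖f - g‖ := by
      rw [norm_mul, norm_mul, Complex.norm_conj]
    have t2 := norm_add_le ((f - g) - (a - b)) ((starRingEnd ℂ) (a - b) * (f * g)
        + (a * (starRingEnd ℂ) b - (starRingEnd ℂ) a * b) * f)
    have t3 := norm_add_le ((starRingEnd ℂ) (a - b) * (f * g))
        ((a * (starRingEnd ℂ) b - (starRingEnd ℂ) a * b) * f)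
    have t4 : ‖(starRingEnd ℂ) (a - b) * (f * g)‖ ≤ ‖a - b‖ * (M * N) := by
      rw [norm_mul, norm_mul, Complex.norm_conj]
      apply mul_le_mul_of_nonneg_left _ (norm_nonneg _)
      exact mul_le_mul hFM hGM (norm_nonneg _) hM0
    have t5 : ‖(a * (starRingEnd ℂ) b - (starRingEnd ℂ) a * b) * f‖
        ≤ (2 * ‖b‖ * ‖a - b‖) * M := by
      rw [norm_mul]
      exact mul_le_mul (im_bound a b) hFM (norm_nonneg _) (by positivity)
    rw [t1]
    linarith
  rw [← hid, norm_mul, norm_mul, norm_mul, hzr] at hn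
  have hr0 : 0 ≤ r := hzr ▸ norm_nonneg z
  have hE1 : 0 ≤ E1 := by
    by_contra hneg
    have := mul_nonneg (norm_nonneg (1 - (starRingEnd ℂ) a * f)) (neg_nonneg.2 (not_le.1 hneg).le)
    linarith
  have hE2 : 0 ≤ E2 := by
    by_contra hneg
    have := mul_nonneg (norm_nonneg (1 - (starRingEnd ℂ) b * g)) (neg_nonneg.2 (not_le.1 hneg).le)
    linarith
  have hd : 1 ≤ (‖1 - (starRingEnd ℂ) a * f‖ * E1) * (‖1 - (starRingEnd ℂ) b * g‖ * E2) := by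
    nlinarith
  calc r * ‖f1 - g1‖ = (r * ‖f1 - g1‖) * 1 := by ring
    _ ≤ (r * ‖f1 - g1‖) *
        ((‖1 - (starRingEnd ℂ) a * f‖ * E1) * (‖1 - (starRingEnd ℂ) b * g‖ * E2)) :=
        mul_le_mul_of_nonneg_left hd (by positivity)
    _ = (E1 * E2) * (r * ‖f1 - g1‖ *
        (‖1 - (starRingEnd ℂ) a * f‖ * ‖1 - (starRingEnd ℂ) b * g‖)) := by ring
    _ ≤ _ := mul_le_mul_of_nonneg_left hn (by positivity)

theorem stmt1 (η r : ℝ) (hη0 : 0 < η) (hη1 : η ≤ 1) (hr0 : 0 < r) (hr1 : r < 1)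
    (F G : ℕ → ℂ → ℂ) (hF : IsSchurChain F) (hG : IsSchurChain G)
    (hηF : η ≤ szego F) (hηG : η ≤ szego G) (n : ℕ) :
    ‖F n 0 - G n 0‖ ≤
      Cconst η r * r ^ (-(n : ℤ)) * L2rT (fun z => F 0 z - G 0 z) r := by
  set c := Real.sqrt (1 - η) with hc
  have hc0 : 0 ≤ c := Real.sqrt_nonneg _
  have hc1 : c < 1 := by
    rw [hc, Real.sqrt_lt' one_pos]; linarith
  set s := 1 / (1 - c) with hs
  have hs0 : 0 ≤ s := one_div_nonneg.2 (by linarith)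
  set h : ℕ → ℂ → ℂ := fun k z => F k z - G k z with hh
  have hd : ∀ k, DifferentiableOn ℂ (h k) (ball 0 1) := fun k => (hF k).1.sub (hG k).1
  set M := Msup F r with hM
  set N := Msup G r with hN
  have hM0 : ∀ k, 0 ≤ M k := Msup_nonneg F r
  have hN0 : ∀ k, 0 ≤ N k := Msup_nonneg G r
  set T : ℕ → ℝ := fun k => s * (‖F k 0‖ * M k) + s * (‖G k 0‖ * N k)
    + ((M k * N k + 2 * (‖G k 0‖ * M k)) + ‖F k 0‖ * ‖G k 0‖) with hT
  have hstep : ∀ k, r ^ 2 * Qsq (h (k + 1)) r ≤ Real.exp (T k) ^ 2 * Qsq (h k) r := by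
    intro k
    have e1 : 0 ≤ M k * N k + 2 * (‖G k 0‖ * M k) := by
      have := hM0 k; have := hN0 k; positivity
    have e2 : 0 ≤ ‖F k 0‖ * ‖G k 0‖ := by positivity
    have h1 := avg_step (h k) (h (k + 1)) r hr0 hr1 (hd k) (hd (k + 1))
      (Real.exp (s * (‖F k 0‖ * M k) + s * (‖G k 0‖ * N k)))
      (M k * N k + 2 * (‖G k 0‖ * M k)) (‖F k 0‖ * ‖G k 0‖) (Real.exp_pos _).le e1 e2
      (fun z hz => pointwise_step hF hG hr1 hc0 hc1 k (coeff_sq_le hF hηF k)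
        (coeff_sq_le hG hηG k) hz)
    refine h1.trans ?_
    apply mul_le_mul_of_nonneg_right _ (Qsq_nonneg _ _)
    apply pow_le_pow_left₀ (by positivity)
    simp only [hT]
    rw [Real.exp_add (s * (‖F k 0‖ * M k) + s * (‖G k 0‖ * N k))]
    apply mul_le_mul_of_nonneg_left _ (Real.exp_pos _).le
    have := Real.add_one_le_exp (M k * N k + 2 * (‖G k 0‖ * M k) + ‖F k 0‖ * ‖G k 0‖)
    linarith
  have hiter : ∀ n, (r ^ n) ^ 2 * Qsq (h n) r
      ≤ Real.exp (∑ k ∈ Finset.range n, T k) ^ 2 * Qsq (h 0) r := by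
    intro n
    induction n with
    | zero => simp
    | succ n ih =>
      rw [Finset.sum_range_succ, Real.exp_add]
      calc (r ^ (n + 1)) ^ 2 * Qsq (h (n + 1)) r
          = (r ^ n) ^ 2 * (r ^ 2 * Qsq (h (n + 1)) r) := by ring
        _ ≤ (r ^ n) ^ 2 * (Real.exp (T n) ^ 2 * Qsq (h n) r) :=
            mul_le_mul_of_nonneg_left (hstep n) (by positivity)
        _ = Real.exp (T n) ^ 2 * ((r ^ n) ^ 2 * Qsq (h n) r) := by ring
        _ ≤ Real.exp (T n) ^ 2 * (Real.exp (∑ k ∈ Finset.range n, T k) ^ 2 * Qsq (h 0) r) :=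
            mul_le_mul_of_nonneg_left ih (by positivity)
        _ = _ := by ring
  have hTsum : ∑ k ∈ Finset.range n, T k
      ≤ Real.log (1 / η) * (2 + s) * (4 / (1 - r) ^ 2 + 1) := by
    have sF := sum_coeff_le hF hη0 hηF n
    have sG := sum_coeff_le hG hη0 hηG n
    have sM := sum_M_le hF hη0 hr0 hr1 hηF n
    have sN := sum_M_le hG hη0 hr0 hr1 hηG n
    have hL : 0 ≤ Real.log (1 / η) := le_trans (Finset.sum_nonneg fun _ _ => by positivity) sF
    have hT1 : ∀ k ∈ Finset.range n, T k ≤ (s / 2 + 1 / 2) * ‖F k 0‖ ^ 2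
        + (s / 2 + 3 / 2) * ‖G k 0‖ ^ 2 + (s / 2 + 3 / 2) * M k ^ 2
        + (s / 2 + 1 / 2) * N k ^ 2 := by
      intro k _
      simp only [hT]
      nlinarith [mul_nonneg hs0 (sq_nonneg (‖F k 0‖ - M k)),
        mul_nonneg hs0 (sq_nonneg (‖G k 0‖ - N k)), sq_nonneg (M k - N k),
        sq_nonneg (‖G k 0‖ - M k), sq_nonneg (‖F k 0‖ - ‖G k 0‖)]
    have h1 := Finset.sum_le_sum hT1
    simp only [Finset.sum_add_distrib, ← Finset.mul_sum] at h1
    have w1 : 0 ≤ s / 2 + 1 / 2 := by linarith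
    have w2 : 0 ≤ s / 2 + 3 / 2 := by linarith
    have a1 := mul_le_mul_of_nonneg_left sF w1
    have a2 := mul_le_mul_of_nonneg_left sG w2
    have a3 := mul_le_mul_of_nonneg_left sM w2
    have a4 := mul_le_mul_of_nonneg_left sN w1
    have hx : 4 / (1 - r) ^ 2 = 4 * (1 / (1 - r) ^ 2) := by ring
    rw [hx]
    have hx0 : 0 ≤ 1 / (1 - r) ^ 2 := by positivity
    generalize 1 / (1 - r) ^ 2 = y at *
    generalize Real.log (1 / η) = L at *
    nlinarith [mul_nonneg (mul_nonneg hL hx0) hs0, mul_nonneg hL hx0]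
  have hC : Real.exp (∑ k ∈ Finset.range n, T k) ≤ Cconst η r := Real.exp_le_exp.2 hTsum
  have h0 := norm_zero_sq_le (h n) r hr0 hr1 (hd n)
  have hQ := Qsq_nonneg (h 0) r
  have hfin : (r ^ n * ‖h n 0‖) ^ 2 ≤ (Cconst η r * Real.sqrt (Qsq (h 0) r)) ^ 2 := by
    calc (r ^ n * ‖h n 0‖) ^ 2 = (r ^ n) ^ 2 * ‖h n 0‖ ^ 2 := by ring
      _ ≤ (r ^ n) ^ 2 * Qsq (h n) r := mul_le_mul_of_nonneg_left h0 (by positivity)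
      _ ≤ _ := hiter n
      _ ≤ Cconst η r ^ 2 * Qsq (h 0) r :=
          mul_le_mul_of_nonneg_right (pow_le_pow_left₀ (Real.exp_pos _).le hC 2) hQ
      _ = _ := by rw [mul_pow, Real.sq_sqrt hQ]
  have hC0 : 0 ≤ Cconst η r := (Real.exp_pos _).le
  have hfin2 := (pow_le_pow_iff_left₀ (by positivity)
    (mul_nonneg hC0 (Real.sqrt_nonneg _)) two_ne_zero).1 hfin
  rw [L2rT_eq, zpow_neg, zpow_natCast]
  change ‖h n 0‖ ≤ Cconst η r * (r ^ n)⁻¹ * Real.sqrt (Qsq (h 0) r)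
  have hrn : 0 < r ^ n := by positivity
  rw [mul_right_comm, ← div_eq_mul_inv, le_div_iff₀ hrn]
  linarith
end
end

section
/- Let t > 0, let n ≥ 1 be an integer, and let r ∈ (0,1]. Then for every z ∈ ℂ with |z| = r one has |P_{n,t}(z) − e^{it(z + 1/z)}| ≤ tⁿ · r^{−n} · e^{t/r} / n!. -/
open Complex Metric Finset Filter

noncomputable section

/-- The Fourier coefficient `c_k(t) = ∫_𝕋 e^{it(ξ + 1/ξ)} ξ^{-k} dm(ξ)`
(equal to `i^k J_k(2t)` with `J_k` the Bessel function of order `k`). -/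
def ck (t : ℝ) (k : ℤ) : ℂ :=
  (2 * Real.pi)⁻¹ •
    ∫ θ in (0:ℝ)..(2 * Real.pi),
      Complex.exp (Complex.I * t * (Complex.exp (θ * Complex.I) +
        (Complex.exp (θ * Complex.I))⁻¹)) * (Complex.exp (θ * Complex.I)) ^ (-k)

/-- The Laurent polynomial `P_{n,t}(z) = Σ_{k=-n}^{n} c_k(t) z^k`. -/
def Pnt (n : ℕ) (t : ℝ) (z : ℂ) : ℂ :=
  ∑ k ∈ Finset.Icc (-(n : ℤ)) (n : ℤ), ck t k * z ^ k

/-- `δ_{n,t} = tⁿ eᵗ / n!`. -/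
def deltant (n : ℕ) (t : ℝ) : ℝ :=
  t ^ n * Real.exp t / (Nat.factorial n : ℝ)

/-- `G_{n,t}(z) = (1 - δ_{n,t}) zⁿ P_{n,t}(z)`. -/
def Gnt (n : ℕ) (t : ℝ) (z : ℂ) : ℂ :=
  ((1 - deltant n t : ℝ) : ℂ) * z ^ n * Pnt n t z


def cf (t : ℝ) (p : ℕ × ℕ) : ℂ :=
  (I * t) ^ p.1 / (p.1.factorial : ℂ) * ((I * t) ^ p.2 / (p.2.factorial : ℂ))

lemma cf_hasSum (t : ℝ) (z : ℂ) (hz : z ≠ 0) :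
    HasSum (fun p : ℕ × ℕ => cf t p * z ^ ((p.1 : ℤ) - p.2)) (exp (I * t * (z + z⁻¹))) := by
  have h (w : ℂ) : HasSum (fun n : ℕ => w ^ n / (n.factorial : ℂ)) (exp w) := by
    rw [Complex.exp_eq_exp_ℂ]; exact NormedSpace.expSeries_div_hasSum_exp w
  have hs (w : ℂ) : Summable (fun n : ℕ => ‖w ^ n / (n.factorial : ℂ)‖) :=
    NormedSpace.norm_expSeries_div_summable w
  have hsum := summable_mul_of_summable_norm (hs (I * t * z)) (hs (I * t * z⁻¹))
  have key := (h (I * t * z)).mul (h (I * t * z⁻¹)) hsum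
  rw [← Complex.exp_add, ← mul_add] at key
  have e : (fun p : ℕ × ℕ => cf t p * z ^ ((p.1 : ℤ) - p.2)) = fun p : ℕ × ℕ =>
      (I * t * z) ^ p.1 / (p.1.factorial : ℂ) * ((I * t * z⁻¹) ^ p.2 / (p.2.factorial : ℂ)) := by
    funext p
    rw [cf, zpow_sub₀ hz, zpow_natCast, zpow_natCast, mul_pow _ z, mul_pow _ z⁻¹, inv_pow]
    generalize (I * t) ^ p.1 = A
    generalize (I * t) ^ p.2 = B
    ring
  rw [e]
  exact key

lemma cf_summable (t : ℝ) : Summable (fun p : ℕ × ℕ => ‖cf t p‖) := by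
  have hs (w : ℂ) : Summable (fun n : ℕ => ‖w ^ n / (n.factorial : ℂ)‖) :=
    NormedSpace.norm_expSeries_div_summable w
  simpa [cf] using (hs (I * t)).mul_of_nonneg (hs (I * t)) (fun _ => norm_nonneg _) (fun _ => norm_nonneg _)

lemma int_zpow (m : ℤ) : ∫ θ in (0:ℝ)..(2 * Real.pi), (exp (θ * I)) ^ m
    = if m = 0 then ((2 * Real.pi : ℝ) : ℂ) else 0 := by
  split_ifs with h
  · subst h; simp
  · have : ∀ θ : ℝ, (exp (θ * I)) ^ m = exp ((m * I) * θ) := by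
      intro θ; rw [← Complex.exp_int_mul]; ring_nf
    simp_rw [this]
    rw [integral_exp_mul_complex (by simp [h])]
    have : (m : ℂ) * I * ((2 * Real.pi : ℝ) : ℂ) = m * (2 * Real.pi * I) := by push_cast; ring
    rw [this, Complex.exp_int_mul_two_pi_mul_I]
    simp

lemma ck_hasSum (t : ℝ) (k : ℤ) :
    HasSum (fun p : ℕ × ℕ => if (p.1 : ℤ) - p.2 = k then cf t p else 0) (ck t k) := by
  have key : HasSum (fun p : ℕ × ℕ => ∫ θ in (0:ℝ)..(2 * Real.pi),
      cf t p * exp (θ * I) ^ ((p.1 : ℤ) - p.2) * exp (θ * I) ^ (-k))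
      (∫ θ in (0:ℝ)..(2 * Real.pi),
      Complex.exp (Complex.I * t * (Complex.exp (θ * Complex.I) +
        (Complex.exp (θ * Complex.I))⁻¹)) * (Complex.exp (θ * Complex.I)) ^ (-k)) := by
    apply intervalIntegral.hasSum_integral_of_dominated_convergence (fun p _ => ‖cf t p‖)
    · intro p
      apply Continuous.aestronglyMeasurable
      simp_rw [← Complex.exp_int_mul]
      fun_prop
    · intro p
      refine Eventually.of_forall fun θ _ => ?_
      simp [norm_exp_ofReal_mul_I]
    · exact Eventually.of_forall fun θ _ => cf_summable t
    · exact intervalIntegrable_const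
    · exact Eventually.of_forall fun θ _ => (cf_hasSum t _ (exp_ne_zero _)).mul_right _
  have := key.const_smul ((2 * Real.pi)⁻¹ : ℝ)
  rw [ck]
  convert this using 2 with p
  have h2 : ∀ θ : ℝ, cf t p * exp (θ * I) ^ ((p.1 : ℤ) - p.2) * exp (θ * I) ^ (-k)
      = cf t p * exp (θ * I) ^ ((p.1 : ℤ) - p.2 - k) := by
    intro θ
    rw [mul_assoc, ← zpow_add₀ (exp_ne_zero _), sub_eq_add_neg _ k]
  simp_rw [h2]
  rw [intervalIntegral.integral_const_mul, int_zpow]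
  by_cases h : (p.1 : ℤ) - p.2 = k
  · have hp : (Real.pi : ℂ) ≠ 0 := by exact_mod_cast Real.pi_ne_zero
    simp [h]
    field_simp
  · simp [h, sub_eq_zero]

lemma laurent_hasSum (t : ℝ) (z : ℂ) (hz : z ≠ 0) :
    HasSum (fun k : ℤ => ck t k * z ^ k) (exp (I * t * (z + z⁻¹))) := by
  have h := cf_hasSum t z hz
  let e := Equiv.sigmaFiberEquiv (fun p : ℕ × ℕ => (p.1 : ℤ) - p.2)
  rw [← e.hasSum_iff] at h
  refine h.sigma fun k => ?_
  have h1 := (ck_hasSum t k).mul_right (z ^ k)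
  have h2 : (fun p : ℕ × ℕ => (if (p.1 : ℤ) - p.2 = k then cf t p else 0) * z ^ k) =
     Set.indicator {p : ℕ × ℕ | (p.1 : ℤ) - p.2 = k}
      (fun p : ℕ × ℕ => cf t p * z ^ ((p.1 : ℤ) - p.2)) := by
    ext p
    by_cases hp : (p.1 : ℤ) - p.2 = k <;> simp [Set.indicator, hp]
  rw [h2, ← hasSum_subtype_iff_indicator] at h1
  exact h1

lemma ck_neg (t : ℝ) (k : ℤ) : ck t (-k) = ck t k := by
  have h := ck_hasSum t (-k)
  rw [← (Equiv.prodComm ℕ ℕ).hasSum_iff] at h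
  refine h.unique ?_
  convert ck_hasSum t k using 2 with p
  have : ((p.2 : ℤ) - p.1 = -k) ↔ ((p.1 : ℤ) - p.2 = k) := by omega
  simp [this, cf, mul_comm]

lemma ck_nat_hasSum (t : ℝ) (k : ℕ) :
    HasSum (fun b : ℕ => cf t (b + k, b)) (ck t k) := by
  have h := ck_hasSum t k
  have hi : Function.Injective (fun b : ℕ => (b + k, b)) := by
    intro a b hab; simpa using congrArg Prod.snd hab
  rw [← hi.hasSum_iff] at h
  · convert h using 2 with b
    simp
  · rintro ⟨a, b⟩ hab
    rw [if_neg]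
    intro h
    apply hab
    refine ⟨b, ?_⟩
    simp at h ⊢
    omega

lemma ck_rec (t : ℝ) (k : ℕ) :
    ck t (k + 1 : ℕ) = ∫ u in (0:ℝ)..1, 2 * I * t * (u : ℂ) ^ (k + 1) * ck (t * u) k := by
  have key : HasSum (fun b : ℕ => ∫ u in (0:ℝ)..1,
      2 * I * t * (u : ℂ) ^ (k + 1) * cf (t * u) (b + k, b))
      (∫ u in (0:ℝ)..1, 2 * I * t * (u : ℂ) ^ (k + 1) * ck (t * u) k) := by
    apply intervalIntegral.hasSum_integral_of_dominated_convergence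
      (fun b _ => 2 * |t| * ‖cf t (b + k, b)‖)
    · intro p
      apply Continuous.aestronglyMeasurable
      unfold cf
      fun_prop
    · intro b
      refine Eventually.of_forall fun u hu => ?_
      rw [Set.uIoc_of_le zero_le_one] at hu
      have h1 : |u| ≤ 1 := abs_le.2 ⟨by linarith [hu.1], hu.2⟩
      have h2 : |u| ^ (k + 1) ≤ 1 := pow_le_one₀ (abs_nonneg _) h1
      have h3 : ‖cf (t * u) (b + k, b)‖ ≤ ‖cf t (b + k, b)‖ := by
        have : |t| * |u| ≤ |t| := mul_le_of_le_one_right (abs_nonneg _) h1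
        simp only [cf, norm_mul, norm_div, norm_pow, norm_I, one_mul, Complex.norm_real,
          Real.norm_eq_abs, ofReal_mul]
        gcongr
      simp only [norm_mul, norm_pow, norm_I, Complex.norm_real, Real.norm_eq_abs, mul_one,
        Complex.norm_ofNat]
      calc 2 * |t| * |u| ^ (k + 1) * ‖cf (t * u) (b + k, b)‖
          ≤ 2 * |t| * 1 * ‖cf t (b + k, b)‖ := by gcongr
        _ = _ := by ring
    · refine Eventually.of_forall fun θ _ => Summable.mul_left _ ?_
      have hi : Function.Injective (fun b : ℕ => (b + k, b)) := by
        intro a b hab; simpa using congrArg Prod.snd hab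
      exact (cf_summable t).comp_injective hi
    · exact intervalIntegrable_const
    · exact Eventually.of_forall fun θ _ => (by
        simpa using (ck_nat_hasSum (t * θ) k).mul_left (2 * I * t * (θ : ℂ) ^ (k + 1)))
  refine (ck_nat_hasSum t (k + 1)).unique ?_
  convert key using 2 with b
  have : ∀ u : ℝ, 2 * I * t * (u : ℂ) ^ (k + 1) * cf (t * u) (b + k, b) =
      (2 * I * t * cf t (b + k, b)) * ((u ^ (2 * b + 2 * k + 1) : ℝ) : ℂ) := by
    intro u
    simp only [cf]
    push_cast
    simp only [mul_pow]
    ring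
  simp_rw [this]
  rw [intervalIntegral.integral_const_mul, intervalIntegral.integral_ofReal, integral_pow]
  simp only [cf, ← add_assoc, Nat.factorial_succ]
  have h1 : ((b : ℂ) + k + 1) ≠ 0 := by exact_mod_cast Nat.succ_ne_zero (b + k)
  have h2 : ((b + k).factorial : ℂ) ≠ 0 := by exact_mod_cast Nat.factorial_ne_zero _
  have h3 : (b.factorial : ℂ) ≠ 0 := by exact_mod_cast Nat.factorial_ne_zero _
  have h4 : (2 * (b : ℂ) + 2 * k + 1 + 1) = 2 * ((b : ℂ) + k + 1) := by ring
  push_cast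
  simp only [h4]
  field_simp
  simp
  ring

lemma ck_bound (k : ℕ) : ∀ t : ℝ, 0 ≤ t → ‖ck t k‖ ≤ t ^ k / (k.factorial : ℝ) := by
  induction k with
  | zero =>
    intro t ht
    have : ‖∫ θ in (0:ℝ)..(2 * Real.pi),
      Complex.exp (Complex.I * t * (Complex.exp (θ * Complex.I) +
        (Complex.exp (θ * Complex.I))⁻¹)) * (Complex.exp (θ * Complex.I)) ^ (-(0:ℤ))‖
        ≤ 1 * |2 * Real.pi - 0| := by
      apply intervalIntegral.norm_integral_le_of_norm_le_const
      intro θ _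
      have : (Complex.exp (θ * Complex.I))⁻¹ = exp (-θ * I) := by
        rw [← Complex.exp_neg]; ring_nf
      rw [this, ← Complex.two_cos]
      have : I * t * (2 * cos (θ : ℂ)) = ((t * (2 * Real.cos θ) : ℝ) : ℂ) * I := by
        push_cast; ring
      rw [this, norm_mul, norm_exp_ofReal_mul_I]
      simp
    have hp := Real.pi_pos
    rw [sub_zero, abs_of_pos (by positivity), one_mul] at this
    simp only [ck, norm_smul, Nat.cast_zero]
    rw [Real.norm_of_nonneg (by positivity)]
    calc _ ≤ (2 * Real.pi)⁻¹ * (2 * Real.pi) := by gcongr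
      _ = _ := by simp; field_simp
  | succ k ih =>
    intro t ht
    rw [ck_rec]
    have : ‖∫ u in (0:ℝ)..1, 2 * I * t * (u : ℂ) ^ (k + 1) * ck (t * u) k‖ ≤
        ∫ u in (0:ℝ)..1, (2 * t ^ (k + 1) / (k.factorial : ℝ)) * u ^ (2 * k + 1) := by
      apply intervalIntegral.norm_integral_le_of_norm_le zero_le_one
      · refine Eventually.of_forall fun u hu => ?_
        have hu0 : 0 ≤ u := hu.1.le
        simp only [norm_mul, norm_pow, norm_I, Complex.norm_real, Real.norm_eq_abs, mul_one,
          Complex.norm_ofNat, abs_of_nonneg ht, abs_of_nonneg hu0]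
        calc _ ≤ 2 * t * u ^ (k + 1) * ((t * u) ^ k / (k.factorial : ℝ)) := by
              gcongr
              exact ih _ (by positivity)
          _ = _ := by rw [mul_pow]; ring
      · apply Continuous.intervalIntegrable
        fun_prop
    refine this.trans (le_of_eq ?_)
    rw [intervalIntegral.integral_const_mul, integral_pow, Nat.factorial_succ]
    push_cast
    have : (2 * (k : ℝ) + 1 + 1) = 2 * (k + 1) := by ring
    rw [this]
    field_simp
    simp

lemma fact_two (n j : ℕ) (hn : 1 ≤ n) (hj : 1 ≤ j) :
    2 * (n.factorial * j.factorial) ≤ (n + j).factorial := by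
  rw [Nat.add_comm n j, ← Nat.add_choose_mul_factorial_mul_factorial j n, mul_assoc, mul_comm j.factorial]
  refine Nat.mul_le_mul_right _ ?_
  have h : 0 < (j + n).choose n := Nat.choose_pos (by omega)
  have h1 : (j + n).choose n ≠ 1 := by
    rw [Ne, Nat.choose_eq_one_iff]; omega
  omega

lemma tail_bound (s : ℝ) (hs : 0 < s) (n : ℕ) (hn : 1 ≤ n) :
    ∃ S : ℝ, HasSum (fun m : ℕ => if m ≤ n then 0 else s ^ m / (m.factorial : ℝ)) S ∧
      2 * S ≤ s ^ n * Real.exp s / (n.factorial : ℝ) := by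
  have he : HasSum (fun m : ℕ => s ^ m / (m.factorial : ℝ)) (Real.exp s) := by
    rw [Real.exp_eq_exp_ℝ]; exact NormedSpace.expSeries_div_hasSum_exp s
  have hsum : Summable (fun m : ℕ => if m ≤ n then 0 else s ^ m / (m.factorial : ℝ)) := by
    refine Summable.of_nonneg_of_le (fun m => ?_) (fun m => ?_) he.summable
    · split_ifs <;> positivity
    · split_ifs
      · positivity
      · exact le_rfl
  refine ⟨_, hsum.hasSum, ?_⟩
  rw [← hsum.sum_add_tsum_nat_add n, Finset.sum_eq_zero, zero_add]
  · have h2 := (he.mul_left (s ^ n / (n.factorial : ℝ) / 2))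
    have : ∑' i : ℕ, (if i + n ≤ n then 0 else s ^ (i + n) / ((i + n).factorial : ℝ)) ≤
        s ^ n / (n.factorial : ℝ) / 2 * Real.exp s := by
      refine hasSum_le (fun j => ?_) ((summable_nat_add_iff n).2 hsum).hasSum h2
      split_ifs with h
      · positivity
      · have := fact_two n j hn (by omega)
        have : 2 * ((n.factorial : ℝ) * j.factorial) ≤ ((j + n).factorial : ℝ) := by
          rw [add_comm j n]; exact_mod_cast this
        calc s ^ (j + n) / ((j + n).factorial : ℝ)
            ≤ s ^ (j + n) / (2 * ((n.factorial : ℝ) * j.factorial)) := by gcongr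
          _ = _ := by rw [pow_add]; field_simp
    calc _ ≤ 2 * (s ^ n / (n.factorial : ℝ) / 2 * Real.exp s) := by gcongr
      _ = _ := by field_simp
  · intro i hi
    rw [if_pos (Finset.mem_range.1 hi).le]

lemma term_bound (t : ℝ) (ht : 0 < t) (r : ℝ) (hr0 : 0 < r) (hr1 : r ≤ 1) (z : ℂ)
    (hz : ‖z‖ = r) (k : ℤ) :
    ‖ck t k * z ^ k‖ ≤ (t / r) ^ k.natAbs / (k.natAbs.factorial : ℝ) := by
  rw [norm_mul, norm_zpow, hz]
  have hc : ‖ck t k‖ ≤ t ^ k.natAbs / (k.natAbs.factorial : ℝ) := by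
    rcases Int.natAbs_eq k with h | h
    · conv_lhs => rw [h]
      exact ck_bound _ t ht.le
    · conv_lhs => rw [h, ck_neg]
      exact ck_bound _ t ht.le
  have hk : r ^ k ≤ (r ^ k.natAbs)⁻¹ := by
    rw [← zpow_natCast, ← zpow_neg]
    exact zpow_le_zpow_right_of_le_one₀ hr0 hr1 (by omega)
  calc _ ≤ t ^ k.natAbs / (k.natAbs.factorial : ℝ) * (r ^ k.natAbs)⁻¹ := by gcongr
    _ = _ := by rw [div_pow]; field_simp

theorem stmt4 (t : ℝ) (ht : 0 < t) (n : ℕ) (hn : 1 ≤ n) (r : ℝ) (hr0 : 0 < r)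
    (hr1 : r ≤ 1) :
    ∀ z : ℂ, ‖z‖ = r →
      ‖Pnt n t z - Complex.exp (Complex.I * t * (z + z⁻¹))‖ ≤
        t ^ n * r ^ (-(n : ℤ)) * Real.exp (t / r) / (Nat.factorial n : ℝ) := by
  intro z hz
  have hz0 : z ≠ 0 := by
    rintro rfl; simp at hz; linarith
  have hL := laurent_hasSum t z hz0
  have hP : HasSum (fun k : ℤ => if k ∈ Finset.Icc (-(n : ℤ)) n then ck t k * z ^ k else 0)
      (Pnt n t z) := by
    have : Pnt n t z = ∑ k ∈ Finset.Icc (-(n : ℤ)) n,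
        (if k ∈ Finset.Icc (-(n : ℤ)) n then ck t k * z ^ k else 0) :=
      Finset.sum_congr rfl fun k hk => by rw [if_pos hk]
    rw [this]
    exact hasSum_sum_of_ne_finset_zero fun k hk => by rw [if_neg hk]
  have hD := hL.sub hP
  obtain ⟨S, hS, hSb⟩ := tail_bound (t / r) (by positivity) n hn
  set b : ℕ → ℝ := fun m : ℕ => if m ≤ n then 0 else (t / r) ^ m / (m.factorial : ℝ) with hb
  have hB : HasSum (fun k : ℤ => b k.natAbs) (2 * S) := by
    have := HasSum.of_nat_of_neg (f := fun k : ℤ => b k.natAbs)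
      (by simpa using hS) (by simpa using hS)
    have b0 : b (0 : ℤ).natAbs = 0 := if_pos (Nat.zero_le n)
    have e : 2 * S = S + S - b (0 : ℤ).natAbs := by rw [b0]; ring
    rw [e]
    exact this
  rw [norm_sub_rev]
  have hle : ‖exp (I * t * (z + z⁻¹)) - Pnt n t z‖ ≤ 2 * S := by
    rw [← hD.tsum_eq]
    refine tsum_of_norm_bounded hB fun k => ?_
    simp only [hb]
    by_cases hk : k ∈ Finset.Icc (-(n : ℤ)) n
    · rw [if_pos hk, sub_self, norm_zero]
      split_ifs <;> positivity
    · rw [if_neg hk, sub_zero, if_neg]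
      · exact term_bound t ht r hr0 hr1 z hz k
      · rw [Finset.mem_Icc] at hk; omega
  refine (hle.trans hSb).trans (le_of_eq ?_)
  rw [div_pow, zpow_neg, zpow_natCast]
  field_simp
end
end
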